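/- Let B be a C*-algebra, A a closed *-subalgebra of B, α = (α_t)_{t≥0} a semigroup of *-endomorphisms of B with α_0 = id, and let E : B → B be an α-expectation onto A. Define P_t : A → A by P_t(a) = E(α_t(a)) (which lies in A since E has range A). Then P_0 = id_A, P_{s+t} = P_s ∘ P_t, and for every family of moment maps [·;·] for (A, P) (i.e. any family satisfying MP1 and MP2), one has E(α_{t_1}(a_1) α_{t_2}(a_2) ⋯ α_{t_k}(a_k)) = [t_1,…,t_k; a_1,…,a_k] for all k ≥ 1, t_1,…,t_k ≥ 0 and a_1,…,a_k ∈ A. -/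

import Mathlib

open scoped NNReal

/-- The ordered product `f 0 * f 1 * ⋯ * f k` of a nonempty finite tuple of
elements of a (possibly nonunital) multiplicative structure. -/
def finProd {B : Type*} [Mul B] : ∀ k : ℕ, (Fin (k + 1) → B) → B
  | 0, f => f 0
  | k + 1, f => f 0 * finProd k fun i => f i.succ

/-- The hereditary subalgebra of `B` generated by `A`: the closed linear span
of `{a * x * b : a, b ∈ A, x ∈ B}`. -/
def heredClosure {B : Type*} [NonUnitalNormedRing B] [NormedSpace ℂ B]
    [IsScalarTower ℂ B B] [SMulCommClass ℂ B B] [StarRing B] [StarModule ℂ B]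
    (A : NonUnitalStarSubalgebra ℂ B) : Set B :=
  closure (↑(Submodule.span ℂ {y : B | ∃ a ∈ A, ∃ b ∈ A, ∃ x : B, y = a * x * b}) : Set B)

/-- `E` is an `α`-expectation onto the closed `*`-subalgebra `A`: a bounded
linear idempotent map with range `A`, positive, an `A`-bimodule map,
equivariant (E1), and multiplicative on the hereditary subalgebra generated
by `A` (E2). -/
def IsAlphaExpectation {B : Type*} [NonUnitalNormedRing B] [StarRing B] [CStarRing B]
    [CompleteSpace B] [NormedSpace ℂ B] [IsScalarTower ℂ B B] [SMulCommClass ℂ B B]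
    [StarModule ℂ B] [PartialOrder B] [StarOrderedRing B]
    (A : NonUnitalStarSubalgebra ℂ B) (α : ℝ≥0 → B →⋆ₙₐ[ℂ] B) (E : B →L[ℂ] B) : Prop :=
  (∀ x : B, E (E x) = E x) ∧
  (Set.range (E : B → B) = (A : Set B)) ∧
  (∀ x : B, 0 ≤ x → 0 ≤ E x) ∧
  (∀ a ∈ A, ∀ x : B, E (a * x) = a * E x) ∧
  (∀ a ∈ A, ∀ x : B, E (x * a) = E x * a) ∧
  (∀ (t : ℝ≥0) (x : B), E (α t (E x)) = E (α t x)) ∧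
  (∀ x ∈ heredClosure A, ∀ y ∈ heredClosure A, E (x * y) = E x * E y)

/-- `IsMomentFamily P M` says that `M` is a family of moment maps for `(A, P)`
satisfying the axioms MP1 and MP2 (with the convention that empty bracket
factors are omitted). -/
def IsMomentFamily {A : Type*} [NonUnitalRing A] [Module ℂ A]
    (P : ℝ≥0 → A →ₗ[ℂ] A)
    (M : ∀ k : ℕ, (Fin (k + 1) → ℝ≥0) → MultilinearMap ℂ (fun _ : Fin (k + 1) => A) A) :
    Prop :=
  (∀ (k : ℕ) (t : Fin (k + 1) → ℝ≥0) (s : ℝ≥0) (a : Fin (k + 1) → A),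
      P s (M k t a) = M k (fun i => t i + s) a) ∧
  (∀ (t : Fin 1 → ℝ≥0) (a : Fin 1 → A), t 0 = 0 → M 0 t a = a 0) ∧
  (∀ (k : ℕ) (t : Fin (k + 1) → ℝ≥0) (c : A) (a : Fin (k + 1) → A),
      M (k + 1) (Fin.cons 0 t) (Fin.cons c a) = c * M k t a) ∧
  (∀ (k : ℕ) (t : Fin (k + 1) → ℝ≥0) (c : A) (a : Fin (k + 1) → A),
      M (k + 1) (Fin.snoc t 0) (Fin.snoc a c) = M k t a * c) ∧
  (∀ (m n : ℕ) (s : Fin (m + 1) → ℝ≥0) (u : Fin (n + 1) → ℝ≥0)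
      (a : Fin (m + 1) → A) (c : A) (b : Fin (n + 1) → A),
      M (m + n + 2)
        (Fin.append s (Fin.cons 0 u) ∘
          Fin.cast (show m + n + 2 + 1 = (m + 1) + (n + 1 + 1) by omega))
        (Fin.append a (Fin.cons c b) ∘
          Fin.cast (show m + n + 2 + 1 = (m + 1) + (n + 1 + 1) by omega)) =
      M m s a * c * M n u b)

theorem finProd_split {B : Type*} [Semigroup B] (n : ℕ) :
    ∀ (m k : ℕ) (hk : k = m + n + 1) (f : Fin (k + 1) → B),
      finProd k f = finProd m (fun i => f ⟨i, by omega⟩) *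
        finProd n (fun j => f ⟨m + 1 + j, by omega⟩) := by
  intro m
  induction m with
  | zero =>
    intro k hk f
    obtain rfl : k = n + 1 := by omega
    simp only [finProd]
    congr 2
    funext i
    congr 1
    ext
    simp [add_comm]
  | succ m ih =>
    intro k hk f
    obtain ⟨k, rfl⟩ : ∃ k', k = k' + 1 := ⟨m + n + 1, by omega⟩
    simp only [finProd]
    rw [ih k (by omega), ← mul_assoc]
    congr 2
    funext i
    congr 1
    ext
    simp only [Fin.val_succ]
    omega

/-- Applying an endomorphism factorwise to an ordered product. -/
theorem map_finProd {B F : Type*} [Mul B] [FunLike F B B] [MulHomClass F B B] (φ : F) :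
    ∀ (k : ℕ) (f : Fin (k + 1) → B), φ (finProd k f) = finProd k fun i => φ (f i)
  | 0, _ => rfl
  | k + 1, f => by
    simp only [finProd, map_mul]
    rw [map_finProd φ k]

namespace IsMomentFamily

variable {A : Type*} [NonUnitalRing A] [Module ℂ A] {P : ℝ≥0 → A →ₗ[ℂ] A}
  {M : ∀ k : ℕ, (Fin (k + 1) → ℝ≥0) → MultilinearMap ℂ (fun _ : Fin (k + 1) => A) A}

theorem apply_of_first_eq_zero (hM : IsMomentFamily P M) (k : ℕ) (t : Fin (k + 2) → ℝ≥0)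
    (a : Fin (k + 2) → A) (ht : t 0 = 0) :
    M (k + 1) t a = a 0 * M k (fun i => t i.succ) (fun i => a i.succ) := by
  have h := hM.2.2.1 k (fun i => t i.succ) (a 0) (fun i => a i.succ)
  rw [← h, ← ht]
  congr 1
  · congr 1
    exact (Fin.cons_self_tail t).symm
  · exact (Fin.cons_self_tail a).symm

theorem apply_of_last_eq_zero (hM : IsMomentFamily P M) (k : ℕ) (t : Fin (k + 2) → ℝ≥0)
    (a : Fin (k + 2) → A) (ht : t (Fin.last _) = 0) :
    M (k + 1) t a =
      M k (fun i => t i.castSucc) (fun i => a i.castSucc) * a (Fin.last _) := by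
  have h := hM.2.2.2.1 k (fun i => t i.castSucc) (a (Fin.last _)) (fun i => a i.castSucc)
  rw [← h, ← ht]
  congr 1
  · congr 1
    exact (Fin.snoc_init_self t).symm
  · exact (Fin.snoc_init_self a).symm

theorem append_cons_eq {C : Type*} (m n : ℕ) (f : Fin (m + n + 2 + 1) → C) :
    Fin.append (fun i : Fin (m + 1) => f ⟨i, by omega⟩)
      (Fin.cons (f ⟨m + 1, by omega⟩) (fun j : Fin (n + 1) => f ⟨m + 1 + (j + 1), by omega⟩)) ∘
        Fin.cast (show m + n + 2 + 1 = (m + 1) + (n + 1 + 1) by omega) = f := by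
  funext i
  obtain ⟨j, rfl⟩ := (finCongr (show (m + 1) + (n + 1 + 1) = m + n + 2 + 1 by omega)).surjective i
  simp only [Function.comp, finCongr_apply, Fin.cast_cast, Fin.cast_eq_self]
  induction j using Fin.addCases with
  | left j =>
    rw [Fin.append_left]
    rfl
  | right j =>
    rw [Fin.append_right]
    induction j using Fin.cases with
    | zero => rfl
    | succ j => rfl

theorem apply_of_middle_eq_zero (hM : IsMomentFamily P M) (m n : ℕ)
    (t : Fin (m + n + 2 + 1) → ℝ≥0) (a : Fin (m + n + 2 + 1) → A)
    (ht : t ⟨m + 1, by omega⟩ = 0) :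
    M (m + n + 2) t a =
      M m (fun i => t ⟨i, by omega⟩) (fun i => a ⟨i, by omega⟩) * a ⟨m + 1, by omega⟩ *
        M n (fun j => t ⟨m + 1 + (j + 1), by omega⟩)
          (fun j => a ⟨m + 1 + (j + 1), by omega⟩) := by
  have h := hM.2.2.2.2 m n (fun i => t ⟨i, by omega⟩)
    (fun j => t ⟨m + 1 + (j + 1), by omega⟩) (fun i => a ⟨i, by omega⟩) (a ⟨m + 1, by omega⟩)
    (fun j => a ⟨m + 1 + (j + 1), by omega⟩)
  rw [← ht, append_cons_eq, append_cons_eq] at h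
  exact h

end IsMomentFamily

/-- A C*-algebra is linearly spanned by products of pairs of its elements. -/
theorem NonUnitalCStarAlgebra.span_mul_eq_top (A : Type*) [NonUnitalCStarAlgebra A] :
    Submodule.span ℂ {c : A | ∃ d e : A, c = d * e} = ⊤ := by
  let _ : PartialOrder A := CStarAlgebra.spectralOrder A
  have _ : StarOrderedRing A := CStarAlgebra.spectralOrderedRing A
  rw [eq_top_iff, ← CStarAlgebra.span_nonneg]
  refine Submodule.span_mono fun c (hc : 0 ≤ c) => ⟨CFC.sqrt c, CFC.sqrt c, ?_⟩
  exact (CFC.sqrt_mul_sqrt_self c hc).symm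

theorem eq_zero_of_forall_mul_mul_eq_zero {B : Type*} [NonUnitalNormedRing B] [StarRing B]
    [CStarRing B] [NormedSpace ℂ B] {A : NonUnitalStarSubalgebra ℂ B} {v : B} (hv : v ∈ A)
    (h : ∀ a ∈ A, ∀ b ∈ A, a * v * b = 0) : v = 0 := by
  have h1 := h (star v) (star_mem hv) (star v * v) (mul_mem (star_mem hv) hv)
  have h2 : star (star v * v) * (star v * v) = 0 := by
    rw [star_mul, star_star]
    exact h1
  exact CStarRing.star_mul_self_eq_zero_iff v |>.1 (CStarRing.star_mul_self_eq_zero_iff _ |>.1 h2)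

theorem mul_mul_mem_heredClosure {B : Type*} [NonUnitalNormedRing B] [NormedSpace ℂ B]
    [IsScalarTower ℂ B B] [SMulCommClass ℂ B B] [StarRing B] [StarModule ℂ B]
    {A : NonUnitalStarSubalgebra ℂ B} {a b : B} (ha : a ∈ A) (hb : b ∈ A) (x : B) :
    a * x * b ∈ heredClosure A :=
  subset_closure (Submodule.subset_span ⟨a, ha, b, hb, x, rfl⟩)

namespace IsAlphaExpectation

variable {B : Type*} [NonUnitalNormedRing B] [StarRing B] [CStarRing B]
  [CompleteSpace B] [NormedSpace ℂ B] [IsScalarTower ℂ B B] [SMulCommClass ℂ B B]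
  [StarModule ℂ B] [PartialOrder B] [StarOrderedRing B]
  {A : NonUnitalStarSubalgebra ℂ B} {α : ℝ≥0 → B →⋆ₙₐ[ℂ] B} {E : B →L[ℂ] B}

theorem apply_mem (hE : IsAlphaExpectation A α E) (x : B) : E x ∈ A := by
  have h : E x ∈ Set.range (E : B → B) := ⟨x, rfl⟩
  rw [hE.2.1] at h
  exact h

theorem apply_of_mem (hE : IsAlphaExpectation A α E) {a : B} (ha : a ∈ A) : E a = a := by
  have h : a ∈ Set.range (E : B → B) := by
    rw [hE.2.1]
    exact ha
  obtain ⟨x, rfl⟩ := h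
  exact hE.1 x

theorem apply_mul_mul_mul (hE : IsAlphaExpectation A α E) {d e : B} (hd : d ∈ A) (he : e ∈ A)
    (x y : B) : E (x * (d * e) * y) = E x * (d * e) * E y := by
  rw [← sub_eq_zero]
  refine eq_zero_of_forall_mul_mul_eq_zero (A := A) (sub_mem (hE.apply_mem _)
    (mul_mem (mul_mem (hE.apply_mem _) (mul_mem hd he)) (hE.apply_mem _))) fun a ha b hb => ?_
  have h := hE.2.2.2.2.2.2 _ (mul_mul_mem_heredClosure ha hd x) _
    (mul_mul_mem_heredClosure he hb y)
  have hleft := hE.2.2.2.1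
  have hright := hE.2.2.2.2.1
  rw [hright d hd, hleft a ha, hright b hb, hleft e he] at h
  rw [mul_sub, sub_mul, ← hleft a ha, ← hright b hb, sub_eq_zero]
  simpa only [mul_assoc] using h

/-- An `α`-expectation splits products at every factor that lies in `A`. -/
theorem apply_mul_mul (hE : IsAlphaExpectation A α E) (hA : IsClosed (A : Set B)) {c : B}
    (hc : c ∈ A) (x y : B) : E (x * c * y) = E x * c * E y := by
  let _ : NonUnitalCStarAlgebra B := {}
  have _ : IsClosed (A : Set B) := hA
  have hmem : (⟨c, hc⟩ : A) ∈ Submodule.span ℂ {c : A | ∃ d e : A, c = d * e} := by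
    rw [NonUnitalCStarAlgebra.span_mul_eq_top A]
    trivial
  suffices h : ∀ c : A, c ∈ Submodule.span ℂ {c : A | ∃ d e : A, c = d * e} →
      E (x * c * y) = E x * c * E y from h _ hmem
  intro c hc
  induction hc using Submodule.span_induction with
  | mem c hc =>
    obtain ⟨d, e, rfl⟩ := hc
    exact hE.apply_mul_mul_mul d.2 e.2 x y
  | zero => simp
  | add c d _ _ hc hd => simp [mul_add, add_mul, hc, hd]
  | smul z c _ hc => simp [mul_smul_comm, smul_mul_assoc, hc]

end IsAlphaExpectation

/-- **Expectation values of an `α`-expectation are moment polynomials.**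
If `E` is an `α`-expectation onto the closed `*`-subalgebra `A` of a
C*-algebra `B`, and `P_t(a) = E(α_t(a))` (a map of `A` into itself), then
`P` is a semigroup with `P_0 = id`, and for every family of moment maps for
`(A, P)` one has
`E(α_{t_1}(a_1) ⋯ α_{t_k}(a_k)) = [t_1,…,t_k; a_1,…,a_k]`. -/
theorem alphaExpectation_moment_values
    {B : Type*} [NonUnitalNormedRing B] [StarRing B] [CStarRing B] [CompleteSpace B]
    [NormedSpace ℂ B] [IsScalarTower ℂ B B] [SMulCommClass ℂ B B]
    [StarModule ℂ B] [PartialOrder B] [StarOrderedRing B]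
    (A : NonUnitalStarSubalgebra ℂ B) (hA : IsClosed (A : Set B))
    (α : ℝ≥0 → B →⋆ₙₐ[ℂ] B) (hα0 : ∀ x : B, α 0 x = x)
    (hαadd : ∀ (s t : ℝ≥0) (x : B), α (s + t) x = α s (α t x))
    (E : B →L[ℂ] B) (hE : IsAlphaExpectation A α E)
    (P : ℝ≥0 → ↥A →ₗ[ℂ] ↥A)
    (hP : ∀ (t : ℝ≥0) (a : ↥A), (P t a : B) = E (α t (a : B))) :
    P 0 = LinearMap.id ∧
    (∀ s t : ℝ≥0, P (s + t) = (P s).comp (P t)) ∧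
    (∀ M, IsMomentFamily P M →
      ∀ (k : ℕ) (t : Fin (k + 1) → ℝ≥0) (a : Fin (k + 1) → ↥A),
        E (finProd k fun i => α (t i) ((a i : B))) = ((M k t a : ↥A) : B)) := by
  obtain ⟨-, -, -, hleft, hright, hequiv, -⟩ := id hE
  refine ⟨?_, ?_, ?_⟩
  · ext a
    rw [hP, hα0, hE.apply_of_mem a.2]
    rfl
  · intro s t
    ext a
    rw [LinearMap.comp_apply, hP, hP, hP, hequiv, hαadd]
  intro M hM k
  induction k using Nat.strong_induction_on with
  | _ k ih =>
  have of_zero : ∀ (t : Fin (k + 1) → ℝ≥0) (a : Fin (k + 1) → A) (l : Fin (k + 1)), t l = 0 →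
      E (finProd k fun i => α (t i) (a i : B)) = (M k t a : B) := by
    intro t a l hl
    obtain ⟨l, hlk⟩ := l
    rcases Nat.eq_zero_or_pos k with rfl | hk
    · obtain rfl : l = 0 := by omega
      rw [hM.2.1 t a hl]
      change E (α (t 0) (a 0 : B)) = _
      rw [show t 0 = 0 from hl, hα0, hE.apply_of_mem (a 0).2]
    rcases Nat.eq_zero_or_pos l with rfl | hl0
    · obtain ⟨k, rfl⟩ : ∃ k', k = k' + 1 := ⟨k - 1, by omega⟩
      rw [hM.apply_of_first_eq_zero k t a hl]
      simp only [finProd]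
      rw [show t 0 = 0 from hl, hα0, hleft _ (a 0).2, ih k (by omega)]
      rfl
    rcases eq_or_lt_of_le (Nat.le_of_lt_succ hlk) with rfl | hlt
    · obtain ⟨k, rfl⟩ : ∃ k', l = k' + 1 := ⟨l - 1, by omega⟩
      rw [hM.apply_of_last_eq_zero k t a hl, finProd_split 0 k (k + 1) rfl]
      change E (_ * α (t ⟨k + 1, hlk⟩) (a ⟨k + 1, hlk⟩ : B)) = _
      rw [hl, hα0, hright _ (a _).2, ih k (by omega)]
      rfl
    · obtain ⟨m, rfl⟩ : ∃ m, l = m + 1 := ⟨l - 1, by omega⟩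
      obtain ⟨n, rfl⟩ : ∃ n, k = m + n + 2 := ⟨k - m - 2, by omega⟩
      rw [hM.apply_of_middle_eq_zero m n t a hl, finProd_split (n + 1) m (m + n + 2) (by omega)]
      change E (_ * (α (t ⟨m + 1, hlk⟩) (a ⟨m + 1, hlk⟩ : B) * finProd n (fun j : Fin (n + 1) =>
        α (t ⟨m + 1 + (j + 1), _⟩) (a ⟨m + 1 + (j + 1), _⟩ : B)))) = _
      rw [hl, hα0, ← mul_assoc, hE.apply_mul_mul hA (a _).2, ih m (by omega), ih n (by omega)]
      rfl
  intro t a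
  obtain ⟨l, hl⟩ := Finite.exists_min t
  have ht : t = fun i => (t i - t l) + t l := by
    funext i
    exact (tsub_add_cancel_of_le (hl i)).symm
  have hprod : (finProd k fun i => α (t i) (a i : B)) =
      α (t l) (finProd k fun i => α (t i - t l) (a i : B)) := by
    rw [map_finProd]
    congr 1
    funext i
    rw [← hαadd, add_tsub_cancel_of_le (hl i)]
  rw [hprod, ← hequiv, of_zero (fun i => t i - t l) a l (tsub_self _), ← hP, hM.1, ← ht]
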